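/- (Multi-receiver equivocation upper bound.) Suppose there are K legitimate receivers, receiver k directly observing side information B_k^N, and one eavesdropper with side information E^N. If the pair (R_A, Δ) is achievable, then Δ ≤ min_{k=1,…,K} sup_{U_k} [ I(A;B_k|U_k) − I(A;E|U_k) ], where for each k the supremum is over finite-valued auxiliary random variables U_k satisfying the Markov chain U_k − A − (B_k, E). -/

import Mathlib

open scoped BigOperators

noncomputable section

namespace SSW

/-- Probability that the random variable `X` takes the value `x`, under the pmf `p`. -/
def pr {Ω α : Type*} [Fintype Ω] (p : Ω → ℝ) (X : Ω → α) (x : α) : ℝ :=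
  ∑ ω, @ite _ (X ω = x) (Classical.propDecidable _) (p ω) 0

/-- Probability of the event `s` under the pmf `p`. -/
def prE {Ω : Type*} [Fintype Ω] (p : Ω → ℝ) (s : Ω → Prop) : ℝ :=
  ∑ ω, @ite _ (s ω) (Classical.propDecidable _) (p ω) 0

/-- Shannon entropy (base 2) of the random variable `X` under the pmf `p`. -/
def H {Ω α : Type*} [Fintype Ω] [Fintype α] (p : Ω → ℝ) (X : Ω → α) : ℝ :=
  ∑ x, -(pr p X x * Real.logb 2 (pr p X x))

/-- Conditional Shannon entropy `H(X|Y) = H(X,Y) - H(Y)` (base 2). -/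
def Hc {Ω α β : Type*} [Fintype Ω] [Fintype α] [Fintype β]
    (p : Ω → ℝ) (X : Ω → α) (Y : Ω → β) : ℝ :=
  H p (fun ω => (X ω, Y ω)) - H p Y

/-- Mutual information `I(X;Y) = H(X) + H(Y) - H(X,Y)` (base 2). -/
def MI {Ω α β : Type*} [Fintype Ω] [Fintype α] [Fintype β]
    (p : Ω → ℝ) (X : Ω → α) (Y : Ω → β) : ℝ :=
  H p X + H p Y - H p (fun ω => (X ω, Y ω))

/-- Conditional mutual information `I(X;Y|Z) = H(X|Z) - H(X|Y,Z)` (base 2). -/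
def cMI {Ω α β γ : Type*} [Fintype Ω] [Fintype α] [Fintype β] [Fintype γ]
    (p : Ω → ℝ) (X : Ω → α) (Y : Ω → β) (Z : Ω → γ) : ℝ :=
  Hc p X Z - Hc p X (fun ω => (Y ω, Z ω))

/-- `p` is a probability mass function on the finite type `Ω`. -/
def IsPMF {Ω : Type*} [Fintype Ω] (p : Ω → ℝ) : Prop :=
  (∀ ω, 0 ≤ p ω) ∧ ∑ ω, p ω = 1

/-- The Markov chain `X − Y − Z`: `X` and `Z` are conditionally independent given `Y`. -/
def Markov {Ω α β γ : Type*} [Fintype Ω] (p : Ω → ℝ)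
    (X : Ω → α) (Y : Ω → β) (Z : Ω → γ) : Prop :=
  ∀ x y z,
    pr p (fun ω => (X ω, Y ω, Z ω)) (x, y, z) * pr p Y y =
      pr p (fun ω => (X ω, Y ω)) (x, y) * pr p (fun ω => (Y ω, Z ω)) (y, z)

/-- `k` is a conditional probability kernel from `α` to `β`. -/
def IsKernel {α β : Type*} [Fintype β] (k : α → β → ℝ) : Prop :=
  ∀ a, (∀ b, 0 ≤ k a b) ∧ ∑ b, k a b = 1

/-- The i.i.d. block pmf on `Fin N → S` induced by the single-letter pmf `p` on `S`. -/
def blk {S : Type*} [Fintype S] (N : ℕ) (p : S → ℝ) : (Fin N → S) → ℝ :=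
  fun ω => ∏ i, p (ω i)

end SSW

open SSW

/-- Achievability of `(R_A, Δ)` for the i.i.d. source `(A, B_1, …, B_K, E) ~ p` with `K`
legitimate receivers (receiver `k` directly observing `B_k^N`) and one eavesdropper with side
information `E^N`. -/
def AchievableMultiRx {𝒜 ℰ : Type} [Fintype 𝒜] [Fintype ℰ] {K : ℕ}
    (ℬ : Fin K → Type) [∀ k, Fintype (ℬ k)]
    (p : 𝒜 × (∀ k, ℬ k) × ℰ → ℝ) (RA Δ : ℝ) : Prop :=
  ∀ ε : ℝ, 0 < ε →
    ∃ (N MA : ℕ), 0 < N ∧ 0 < MA ∧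
      ∃ (fA : (Fin N → 𝒜) → Fin MA)
        (g : ∀ k, Fin MA → (Fin N → ℬ k) → (Fin N → 𝒜)),
        Real.logb 2 (MA : ℝ) ≤ N * (RA + ε) ∧
        (∀ k, prE (blk N p)
          (fun ω => g k (fA (fun i => (ω i).1)) (fun i => (ω i).2.1 k) ≠
            (fun i => (ω i).1)) < ε) ∧
        Hc (blk N p) (fun ω => (fun i => (ω i).1))
          (fun ω => (fA (fun i => (ω i).1), fun i => (ω i).2.2)) ≥ N * (Δ - ε)


namespace SSW

section Basic

variable {Ω α β γ : Type*} [Fintype Ω] {p : Ω → ℝ}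

/-- Expectation of a function of `X` computed from the law of `X`. -/
lemma sum_mul_comp [Fintype α] (p : Ω → ℝ) (X : Ω → α) (h : α → ℝ) :
    ∑ ω, p ω * h (X ω) = ∑ x, pr p X x * h x := by
  simp only [pr, Finset.sum_mul]
  rw [Finset.sum_comm]
  refine Finset.sum_congr rfl fun ω _ => ?_
  rw [Finset.sum_eq_single (X ω)]
  · simp
  · intro x _ hx
    simp [hx.symm]
  · simp

lemma sum_pr [Fintype α] (p : Ω → ℝ) (X : Ω → α) : ∑ x, pr p X x = ∑ ω, p ω := by
  simpa using (sum_mul_comp p X fun _ => 1).symm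

lemma pr_nonneg (hp : ∀ ω, 0 ≤ p ω) (X : Ω → α) (x : α) : 0 ≤ pr p X x :=
  Finset.sum_nonneg fun ω _ => by split_ifs <;> simp [hp]

lemma pr_mono (hp : ∀ ω, 0 ≤ p ω) {X : Ω → α} {Y : Ω → β} {x : α} {y : β}
    (h : ∀ ω, X ω = x → Y ω = y) : pr p X x ≤ pr p Y y := by
  refine Finset.sum_le_sum fun ω _ => ?_
  by_cases hx : X ω = x
  · simp [hx, h ω hx]
  · rw [if_neg hx]
    split_ifs <;> simp [hp]

lemma pr_congr {X : Ω → α} {Y : Ω → β} {x : α} {y : β}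
    (h : ∀ ω, X ω = x ↔ Y ω = y) : pr p X x = pr p Y y := by
  simp only [pr]
  refine Finset.sum_congr rfl fun ω _ => ?_
  by_cases hx : X ω = x
  · rw [if_pos hx, if_pos ((h ω).1 hx)]
  · rw [if_neg hx, if_neg fun hy => hx ((h ω).2 hy)]

lemma pr_apply_pos (hp : ∀ ω, 0 ≤ p ω) (X : Ω → α) {ω : Ω} (hω : p ω ≠ 0) :
    0 < pr p X (X ω) := by
  refine lt_of_lt_of_le (lt_of_le_of_ne (hp ω) hω.symm) ?_
  have := Finset.single_le_sum
    (f := fun ω' => @ite _ (X ω' = X ω) (Classical.propDecidable _) (p ω') 0)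
    (fun ω' _ => by split_ifs <;> simp [hp]) (Finset.mem_univ ω)
  rw [if_pos rfl] at this
  exact this

lemma H_eq_expect [Fintype α] (p : Ω → ℝ) (X : Ω → α) :
    H p X = ∑ ω, p ω * -Real.logb 2 (pr p X (X ω)) := by
  rw [sum_mul_comp p X fun x => -Real.logb 2 (pr p X x)]
  simp [H]

/-- Entropy only depends on the partition induced by the random variable. -/
lemma H_congr [Fintype α] [Fintype β] {X : Ω → α} {Y : Ω → β}
    (h : ∀ ω ω', X ω = X ω' ↔ Y ω = Y ω') : H p X = H p Y := by
  simp only [H_eq_expect]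
  exact Finset.sum_congr rfl fun ω _ => by rw [pr_congr fun ω' => h ω' ω]

lemma Hc_nonneg [Fintype α] [Fintype β] (hp : ∀ ω, 0 ≤ p ω) (X : Ω → α) (Y : Ω → β) :
    0 ≤ Hc p X Y := by
  rw [Hc, sub_nonneg, H_eq_expect, H_eq_expect]
  refine Finset.sum_le_sum fun ω _ => ?_
  by_cases hω : p ω = 0
  · simp [hω]
  refine mul_le_mul_of_nonneg_left (neg_le_neg ?_) (hp ω)
  refine Real.logb_le_logb_of_le one_lt_two (pr_apply_pos hp (fun ω => (X ω, Y ω)) hω) ?_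
  exact pr_mono hp fun ω' h => (Prod.ext_iff.1 h).2

/-- Conditional Gibbs inequality: conditional entropy is at most the cross entropy with respect
to any positive subprobability kernel. -/
lemma Hc_le_cross [Fintype α] [Fintype β] (hp : IsPMF p) (X : Ω → α) (Y : Ω → β)
    (r : α → β → ℝ) (hr : ∀ x y, 0 < r x y) (hr1 : ∀ y, ∑ x, r x y ≤ 1) :
    Hc p X Y ≤ ∑ ω, p ω * -Real.logb 2 (r (X ω) (Y ω)) := by
  set XY : Ω → α × β := fun ω => (X ω, Y ω)
  have hpt : ∀ ω, p ω * -Real.logb 2 (pr p XY (XY ω)) - p ω * -Real.logb 2 (pr p Y (Y ω))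
      - p ω * -Real.logb 2 (r (X ω) (Y ω)) ≤
      (p ω * (r (XY ω).1 (XY ω).2 * pr p Y (XY ω).2 / pr p XY (XY ω)) - p ω) / Real.log 2 := by
    intro ω
    by_cases hω : p ω = 0
    · simp [hω]
    have h1 := pr_apply_pos hp.1 XY hω
    have h2 := pr_apply_pos hp.1 Y hω
    have h3 := hr (X ω) (Y ω)
    have hl := Real.log_le_sub_one_of_pos (div_pos (mul_pos h3 h2) h1)
    rw [Real.log_div (mul_pos h3 h2).ne' h1.ne', Real.log_mul h3.ne' h2.ne'] at hl
    rw [le_div_iff₀ (Real.log_pos one_lt_two)]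
    have h2l := (Real.log_pos one_lt_two).ne'
    calc _ = p ω * (Real.log (r (X ω) (Y ω)) + Real.log (pr p Y (Y ω))
          - Real.log (pr p XY (XY ω))) := by
            simp only [Real.logb]; field_simp; ring
      _ ≤ p ω * (r (X ω) (Y ω) * pr p Y (Y ω) / pr p XY (XY ω) - 1) :=
            mul_le_mul_of_nonneg_left hl (hp.1 ω)
      _ = _ := by ring
  have hsum := Finset.sum_le_sum fun ω (_ : ω ∈ Finset.univ) => hpt ω
  rw [← Finset.sum_div, Finset.sum_sub_distrib, Finset.sum_sub_distrib, Finset.sum_sub_distrib,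
    ← H_eq_expect, ← H_eq_expect, hp.2,
    sum_mul_comp p XY fun z => r z.1 z.2 * pr p Y z.2 / pr p XY z] at hsum
  have hle : ∑ z, pr p XY z * (r z.1 z.2 * pr p Y z.2 / pr p XY z) ≤ 1 := by
    calc _ ≤ ∑ z : α × β, r z.1 z.2 * pr p Y z.2 := by
          refine Finset.sum_le_sum fun z _ => ?_
          by_cases hz : pr p XY z = 0
          · rw [hz, zero_mul]
            exact mul_nonneg (hr _ _).le (pr_nonneg hp.1 _ _)
          · rw [mul_div_cancel₀ _ hz]
      _ = ∑ y, (∑ x, r x y) * pr p Y y := by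
          rw [Fintype.sum_prod_type_right]
          simp only [Finset.sum_mul]
      _ ≤ ∑ y, pr p Y y :=
          Finset.sum_le_sum fun y _ => mul_le_of_le_one_left (pr_nonneg hp.1 _ _) (hr1 y)
      _ = 1 := by rw [sum_pr, hp.2]
  have h0 : (∑ z, pr p XY z * (r z.1 z.2 * pr p Y z.2 / pr p XY z) - 1) / Real.log 2 ≤ 0 :=
    div_nonpos_of_nonpos_of_nonneg (by linarith) (Real.log_pos one_lt_two).le
  rw [Hc]
  linarith

lemma IsPMF.nonempty (hp : IsPMF p) : Nonempty Ω := by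
  by_contra h
  rw [not_nonempty_iff] at h
  simpa using hp.2

lemma Hc_le_logb_card [Fintype α] [Fintype β] (hp : IsPMF p) (X : Ω → α) (Y : Ω → β) :
    Hc p X Y ≤ Real.logb 2 (Fintype.card α) := by
  have : Nonempty α := hp.nonempty.map X
  have hc : (0 : ℝ) < Fintype.card α := by exact_mod_cast Fintype.card_pos
  refine (Hc_le_cross hp X Y (fun _ _ => (Fintype.card α : ℝ)⁻¹)
    (fun _ _ => inv_pos.2 hc) fun _ => ?_).trans ?_
  · simp [hc.ne']
  · rw [← Finset.sum_mul, hp.2, Real.logb_inv]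
    simp

/-- A form of Fano's inequality that is convenient for a vanishing error probability. -/
lemma Hc_le_of_decoder [Fintype α] [Fintype β] (hp : IsPMF p) (X : Ω → α) (Y : Ω → β)
    (g : β → α) {ε : ℝ} (hε : 0 < ε) (hε1 : ε < 1) (herr : prE p (fun ω => g (Y ω) ≠ X ω) < ε) :
    Hc p X Y ≤ -Real.logb 2 (1 - ε) +
      ε * (-Real.logb 2 ε + Real.logb 2 (Fintype.card α)) := by
  classical
  have : Nonempty α := hp.nonempty.map X
  have hc : (1 : ℝ) ≤ Fintype.card α := by exact_mod_cast Fintype.card_pos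
  have hc0 : (0 : ℝ) < Fintype.card α := by linarith
  have hd : 0 < ε / Fintype.card α := div_pos hε hc0
  set D := -Real.logb 2 ε + Real.logb 2 (Fintype.card α)
  have hD : 0 ≤ D := by
    have h1 := Real.logb_nonpos one_lt_two hε.le hε1.le
    have h2 := Real.logb_nonneg one_lt_two hc
    simp only [D]; linarith
  have hl : 0 ≤ -Real.logb 2 (1 - ε) := by
    have := Real.logb_nonpos one_lt_two (x := 1 - ε) (by linarith) (by linarith)
    linarith
  refine (Hc_le_cross hp X Y (fun x y => if g y = x then 1 - ε else ε / Fintype.card α)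
    (fun x y => by split_ifs <;> linarith) fun y => ?_).trans ?_
  · calc _ ≤ ∑ x, ((if g y = x then 1 - ε else 0) + ε / Fintype.card α) := by
          refine Finset.sum_le_sum fun x _ => ?_
          split_ifs <;> linarith
      _ = 1 := by
          rw [Finset.sum_add_distrib]
          simp [hc0.ne', mul_div_cancel₀]
  · calc _ ≤ ∑ ω, (p ω * -Real.logb 2 (1 - ε) +
            (@ite _ (g (Y ω) ≠ X ω) (Classical.propDecidable _) (p ω) 0) * D) := by
          refine Finset.sum_le_sum fun ω _ => ?_
          by_cases h : g (Y ω) = X ω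
          · simp [h]
          · have : Real.logb 2 (ε / Fintype.card α) = -D := by
              rw [Real.logb_div hε.ne' hc0.ne']; simp only [D]; ring
            have h0 := mul_nonneg (hp.1 ω) hl
            simp only [h, if_false, this, ne_eq, not_false_eq_true, if_true, neg_neg]
            linarith
      _ = -Real.logb 2 (1 - ε) + prE p (fun ω => g (Y ω) ≠ X ω) * D := by
          rw [Finset.sum_add_distrib, ← Finset.sum_mul, ← Finset.sum_mul, hp.2, one_mul, prE]
      _ ≤ _ := by
          have := mul_le_mul_of_nonneg_right herr.le hD
          linarith

/-- Entropy identity expressing conditional independence of `X` and `Z` given `Y`. -/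
lemma Markov.H_add_H [Fintype α] [Fintype β] [Fintype γ] (hp : ∀ ω, 0 ≤ p ω)
    {X : Ω → α} {Y : Ω → β} {Z : Ω → γ} (h : Markov p X Y Z) :
    H p (fun ω => (X ω, Y ω, Z ω)) + H p Y =
      H p (fun ω => (X ω, Y ω)) + H p (fun ω => (Y ω, Z ω)) := by
  simp only [H_eq_expect, ← Finset.sum_add_distrib]
  refine Finset.sum_congr rfl fun ω _ => ?_
  by_cases hω : p ω = 0
  · simp [hω]
  have h1 := (pr_apply_pos hp (fun ω => (X ω, Y ω, Z ω)) hω).ne'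
  have h2 := (pr_apply_pos hp Y hω).ne'
  have h3 := (pr_apply_pos hp (fun ω => (X ω, Y ω)) hω).ne'
  have h4 := (pr_apply_pos hp (fun ω => (Y ω, Z ω)) hω).ne'
  have := congrArg (Real.logb 2) (h (X ω) (Y ω) (Z ω))
  rw [Real.logb_mul h1 h2, Real.logb_mul h3 h4] at this
  linear_combination (-p ω) * this

lemma cMI_sub_cMI {δ : Type*} [Fintype α] [Fintype β] [Fintype γ] [Fintype δ]
    (hp : ∀ ω, 0 ≤ p ω) {U : Ω → α} {A : Ω → β} {B : Ω → γ} {E : Ω → δ}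
    (hB : Markov p U A B) (hE : Markov p U A E) :
    cMI p A B U - cMI p A E U =
      (H p (fun ω => (A ω, E ω)) - H p (fun ω => (A ω, B ω))) +
        (H p (fun ω => (B ω, U ω)) - H p (fun ω => (E ω, U ω))) := by
  have h1 := hB.H_add_H hp
  have h2 := hE.H_add_H hp
  have h3 : H p (fun ω => (A ω, B ω, U ω)) = H p (fun ω => (U ω, A ω, B ω)) :=
    H_congr fun ω ω' => by simp only [Prod.mk.injEq]; tauto
  have h4 : H p (fun ω => (A ω, E ω, U ω)) = H p (fun ω => (U ω, A ω, E ω)) :=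
    H_congr fun ω ω' => by simp only [Prod.mk.injEq]; tauto
  simp only [cMI, Hc, h3, h4]
  linarith

lemma cMI_sub_cMI_le {δ : Type*} [Fintype α] [Fintype β] [Fintype γ] [Fintype δ]
    (hp : IsPMF p) (A : Ω → α) (B : Ω → β) (E : Ω → γ) (U : Ω → δ) :
    cMI p A B U - cMI p A E U ≤ Real.logb 2 (Fintype.card α) := by
  have h1 := Hc_nonneg hp.1 A fun ω => (B ω, U ω)
  have h2 := Hc_le_logb_card hp A fun ω => (E ω, U ω)
  simp only [cMI]
  linarith

lemma pr_pr [Fintype α] (p : Ω → ℝ) (T : Ω → α) (X : α → β) (x : β) :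
    pr (pr p T) X x = pr p (fun ω => X (T ω)) x := by
  classical
  have := sum_mul_comp p T fun t => if X t = x then 1 else 0
  simp only [mul_ite, mul_one, mul_zero] at this
  simp only [pr] at this ⊢
  convert this.symm using 2

lemma H_pr [Fintype α] [Fintype β] (p : Ω → ℝ) (T : Ω → α) (X : α → β) :
    H (pr p T) X = H p (fun ω => X (T ω)) := by
  simp only [H, pr_pr]

lemma isPMF_pr [Fintype α] (hp : IsPMF p) (T : Ω → α) : IsPMF (pr p T) :=
  ⟨pr_nonneg hp.1 T, by rw [sum_pr, hp.2]⟩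

end Basic

section Block

variable {S α β γ : Type*} [Fintype S] {p : S → ℝ}

lemma isPMF_blk (hp : IsPMF p) (N : ℕ) : IsPMF (blk N p) := by
  refine ⟨fun ω => Finset.prod_nonneg fun i _ => hp.1 _, ?_⟩
  simp only [blk]
  rw [← Fintype.piFinset_univ, ← Finset.prod_univ_sum]
  simp [hp.2]

lemma pr_blk {N : ℕ} (X : S → α) (x : Fin N → α) :
    pr (blk N p) (fun ω i => X (ω i)) x = ∏ i, pr p X (x i) := by
  simp only [pr]
  rw [Finset.prod_univ_sum, Fintype.piFinset_univ]
  refine Finset.sum_congr rfl fun ω _ => ?_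
  by_cases h : ∀ i, X (ω i) = x i
  · rw [if_pos (funext h)]
    simp [h, blk]
  · rw [if_neg fun h' => h (congrFun h')]
    push Not at h
    obtain ⟨i, hi⟩ := h
    exact (Finset.prod_eq_zero (Finset.mem_univ i) (if_neg hi)).symm

/-- Fubini: isolate coordinate `i` in an expectation under the block pmf. -/
lemma sum_blk_split {N : ℕ} (i : Fin N) (F : (Fin N → S) → ℝ) :
    ∑ ω, blk N p ω * F ω = ∑ s, p s * ∑ r : {j // j ≠ i} → S,
      (∏ j, p (r j)) * F ((Equiv.funSplitAt i S).symm (s, r)) := by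
  rw [← (Equiv.funSplitAt i S).symm.sum_comp, Fintype.sum_prod_type]
  refine Finset.sum_congr rfl fun s _ => ?_
  rw [Finset.mul_sum]
  refine Finset.sum_congr rfl fun r _ => ?_
  rw [← mul_assoc]
  congr 1
  rw [blk, Fintype.prod_eq_mul_prod_subtype_ne _ i]
  congr 1
  · simp
  · exact Finset.prod_congr rfl fun j _ => by simp [j.2]

lemma sum_blk_coord (hp : IsPMF p) {N : ℕ} (i : Fin N) (h : S → ℝ) :
    ∑ ω, blk N p ω * h (ω i) = ∑ s, p s * h s := by
  rw [sum_blk_split i]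
  refine Finset.sum_congr rfl fun s _ => ?_
  congr 1
  have h1 : ∑ r : {j // j ≠ i} → S, ∏ j, p (r j) = 1 := by
    rw [← Fintype.piFinset_univ, ← Finset.prod_univ_sum]
    simp [hp.2]
  simp [← Finset.sum_mul, h1]

lemma pr_blk_coord (hp : IsPMF p) {N : ℕ} (i : Fin N) (X : S → α) (x : α) :
    pr (blk N p) (fun ω => X (ω i)) x = pr p X x := by
  classical
  have := sum_blk_coord hp i fun s => if X s = x then 1 else 0
  simp only [mul_ite, mul_one, mul_zero] at this
  simp only [pr]
  convert this using 2

lemma H_blk_coord [Fintype α] (hp : IsPMF p) {N : ℕ} (i : Fin N) (X : S → α) :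
    H (blk N p) (fun ω => X (ω i)) = H p X := by
  simp only [H, pr_blk_coord hp]

lemma H_blk [Fintype α] (hp : IsPMF p) {N : ℕ} (X : S → α) :
    H (blk N p) (fun ω i => X (ω i)) = N * H p X := by
  rw [H_eq_expect, H_eq_expect]
  have h : ∀ ω : Fin N → S,
      blk N p ω * -Real.logb 2 (pr (blk N p) (fun ω i => X (ω i)) (fun i => X (ω i))) =
        ∑ i, blk N p ω * -Real.logb 2 (pr p X (X (ω i))) := by
    intro ω
    by_cases hω : blk N p ω = 0
    · simp [hω]
    have hi : ∀ i, p (ω i) ≠ 0 := fun i => (Finset.prod_ne_zero_iff.1 hω) i (Finset.mem_univ i)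
    rw [pr_blk, Real.logb_prod _ _ fun i _ => (pr_apply_pos hp.1 X (hi i)).ne',
      ← Finset.mul_sum, Finset.sum_neg_distrib]
  rw [Finset.sum_congr rfl fun ω _ => h ω, Finset.sum_comm]
  rw [Finset.sum_congr rfl fun i _ => sum_blk_coord hp i fun s => -Real.logb 2 (pr p X (X s))]
  simp

/-- If `U` depends on coordinate `i` only through `a (ω i)`, then `U − a (ω i) − y (ω i)` is a
Markov chain under the block pmf. -/
lemma markov_blk (hp : IsPMF p) {N : ℕ} (i : Fin N) (U : (Fin N → S) → γ) (a : S → α) (y : S → β)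
    (hU : ∀ ω ω', a (ω i) = a (ω' i) → (∀ j, j ≠ i → ω j = ω' j) → U ω = U ω') :
    Markov (blk N p) U (fun ω => a (ω i)) (fun ω => y (ω i)) := by
  classical
  intro u a₀ y₀
  have key : ∃ c : ℝ, ∀ f : S → Prop,
      (∑ ω, blk N p ω * if U ω = u ∧ a (ω i) = a₀ ∧ f (ω i) then 1 else 0) =
        c * ∑ s, p s * if a s = a₀ ∧ f s then 1 else 0 := by
    by_cases hs : ∃ s₀, a s₀ = a₀
    · obtain ⟨s₀, rfl⟩ := hs
      refine ⟨∑ r : {j // j ≠ i} → S,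
        (∏ j, p (r j)) * if U ((Equiv.funSplitAt i S).symm (s₀, r)) = u then 1 else 0,
        fun f => ?_⟩
      rw [sum_blk_split i, Finset.mul_sum]
      refine Finset.sum_congr rfl fun s _ => ?_
      rw [mul_left_comm]
      congr 1
      by_cases h : a s = a s₀ ∧ f s
      · have : ∀ r, U ((Equiv.funSplitAt i S).symm (s, r)) =
            U ((Equiv.funSplitAt i S).symm (s₀, r)) := fun r =>
          hU _ _ (by simp [h.1]) fun j hj => by simp [hj]
        simp [h, this]
      · simp [h]
    · push Not at hs
      exact ⟨0, fun f => by simp [hs]⟩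
  obtain ⟨c, hc⟩ := key
  have h1 := hc fun s => y s = y₀
  have h2 := hc fun _ => True
  have e1 := pr_blk_coord hp i a a₀
  have e2 := pr_blk_coord hp i (fun s => (a s, y s)) (a₀, y₀)
  have e3 : pr (blk N p) (fun ω => (U ω, a (ω i), y (ω i))) (u, a₀, y₀) =
      c * pr p (fun s => (a s, y s)) (a₀, y₀) := by
    simpa [pr, Prod.ext_iff] using h1
  have e4 : pr (blk N p) (fun ω => (U ω, a (ω i))) (u, a₀) = c * pr p a a₀ := by
    simpa [pr, Prod.ext_iff] using h2
  rw [e1, e2, e3, e4]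
  ring

/-- The auxiliary variable of coordinate `i`: the message, the past of `b` and the future of `e`. -/
def auxVar {β ε : Type*} {N : ℕ} (J : (Fin N → α) → γ) (a : S → α) (b : S → β) (e : S → ε)
    (i : Fin N) (ω : Fin N → S) : γ × (Fin N → Option (β ⊕ ε)) :=
  (J fun j => a (ω j), fun j =>
    if j < i then some (.inl (b (ω j))) else if i < j then some (.inr (e (ω j))) else none)

/-- The message together with the sequence equal to `b` before time `m` and to `e` from `m` on. -/
def hybrid {β ε : Type*} {N : ℕ} (J : (Fin N → α) → γ) (a : S → α) (b : S → β) (e : S → ε)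
    (m : ℕ) (ω : Fin N → S) : γ × (Fin N → β ⊕ ε) :=
  (J fun j => a (ω j), fun j => if (j : ℕ) < m then .inl (b (ω j)) else .inr (e (ω j)))

lemma markov_auxVar (hp : IsPMF p) {N : ℕ} {ε δ : Type*} (J : (Fin N → α) → γ) (a : S → α)
    (b : S → β) (e : S → ε) (i : Fin N) (y : S → δ) :
    Markov (blk N p) (auxVar J a b e i) (fun ω => a (ω i)) (fun ω => y (ω i)) := by
  refine markov_blk hp i _ a y fun ω ω' hi h => ?_
  simp only [auxVar, Prod.mk.injEq]
  refine ⟨congrArg J (funext fun j => ?_), funext fun j => ?_⟩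
  · by_cases hj : j = i
    · rw [hj, hi]
    · rw [h j hj]
  · by_cases hj : j = i
    · simp [hj]
    · rw [h j hj]

lemma H_blk_message [Fintype α] [Fintype β] [Fintype γ] (hp : IsPMF p) {N : ℕ}
    (J : (Fin N → α) → γ) (a : S → α) (y : S → β) :
    H (blk N p) (fun ω => ((fun i => a (ω i)), J (fun j => a (ω j)), fun j => y (ω j))) =
      N * H p (fun s => (a s, y s)) := by
  rw [← H_blk hp]
  refine H_congr fun ω ω' => ?_
  simp only [Prod.mk.injEq, funext_iff, forall_and]
  exact ⟨fun h => ⟨h.1, h.2.2⟩, fun h => ⟨h.1, congrArg J (funext h.1), h.2⟩⟩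

variable {ε : Type*} [Fintype β] [Fintype γ] [Fintype ε]

lemma H_hybrid_succ {N : ℕ} (P : (Fin N → S) → ℝ) (J : (Fin N → α) → γ) (a : S → α) (b : S → β)
    (e : S → ε) (i : Fin N) :
    H P (hybrid J a b e (i + 1)) = H P (fun ω => (b (ω i), auxVar J a b e i ω)) := by
  refine H_congr fun ω ω' => ?_
  simp only [hybrid, auxVar, Prod.mk.injEq, funext_iff]
  refine ⟨fun ⟨hJ, h⟩ => ⟨?_, hJ, fun j => ?_⟩, fun ⟨hi, hJ, h⟩ => ⟨hJ, fun j => ?_⟩⟩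
  · simpa using h i
  · have := h j
    rcases lt_trichotomy j i with hj | rfl | hj
    · have h1 : (j : ℕ) < i + 1 := by have : (j : ℕ) < i := hj; omega
      simpa [hj, h1] using this
    · simp
    · have h1 : ¬ (j : ℕ) < i + 1 := by have : (i : ℕ) < j := hj; omega
      simpa [hj, h1, hj.not_gt] using this
  · have := h j
    rcases lt_trichotomy j i with hj | rfl | hj
    · have h1 : (j : ℕ) < i + 1 := by have : (j : ℕ) < i := hj; omega
      simpa [hj, h1] using this
    · simpa using hi
    · have h1 : ¬ (j : ℕ) < i + 1 := by have : (i : ℕ) < j := hj; omega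
      simpa [hj, h1, hj.not_gt] using this

lemma H_hybrid {N : ℕ} (P : (Fin N → S) → ℝ) (J : (Fin N → α) → γ) (a : S → α) (b : S → β)
    (e : S → ε) (i : Fin N) :
    H P (hybrid J a b e i) = H P (fun ω => (e (ω i), auxVar J a b e i ω)) := by
  refine H_congr fun ω ω' => ?_
  simp only [hybrid, auxVar, Prod.mk.injEq, funext_iff]
  refine ⟨fun ⟨hJ, h⟩ => ⟨?_, hJ, fun j => ?_⟩, fun ⟨hi, hJ, h⟩ => ⟨hJ, fun j => ?_⟩⟩
  · simpa using h i
  · have := h j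
    rcases lt_trichotomy j i with hj | rfl | hj
    · simpa [hj] using this
    · simp
    · simpa [hj, hj.not_gt] using this
  · have := h j
    rcases lt_trichotomy j i with hj | rfl | hj
    · simpa [hj] using this
    · simpa using hi
    · simpa [hj, hj.not_gt] using this

lemma sum_H_auxVar_sub {N : ℕ} (P : (Fin N → S) → ℝ) (J : (Fin N → α) → γ) (a : S → α)
    (b : S → β) (e : S → ε) :
    ∑ i, (H P (fun ω => (b (ω i), auxVar J a b e i ω)) -
        H P (fun ω => (e (ω i), auxVar J a b e i ω))) =
      H P (fun ω => (J fun j => a (ω j), fun j => b (ω j))) -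
        H P (fun ω => (J fun j => a (ω j), fun j => e (ω j))) := by
  simp only [← H_hybrid_succ, ← H_hybrid]
  rw [Fin.sum_univ_eq_sum_range
    fun m => H P (hybrid J a b e (m + 1)) - H P (hybrid J a b e m),
    Finset.sum_range_sub fun m => H P (hybrid J a b e m)]
  congr 1 <;> refine H_congr fun ω ω' => ?_ <;> simp [hybrid, funext_iff]

/-- Single-letterization of the difference of conditional entropies given the message. -/
lemma Hc_sub_Hc_eq_sum [Fintype α] (hp : IsPMF p) {N : ℕ} (J : (Fin N → α) → γ) (a : S → α)
    (b : S → β) (e : S → ε) :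
    Hc (blk N p) (fun ω i => a (ω i)) (fun ω => (J fun j => a (ω j), fun j => e (ω j))) -
      Hc (blk N p) (fun ω i => a (ω i)) (fun ω => (J fun j => a (ω j), fun j => b (ω j))) =
    ∑ i, (cMI (blk N p) (fun ω => a (ω i)) (fun ω => b (ω i)) (auxVar J a b e i) -
      cMI (blk N p) (fun ω => a (ω i)) (fun ω => e (ω i)) (auxVar J a b e i)) := by
  simp only [cMI_sub_cMI (isPMF_blk hp N).1 (markov_auxVar hp J a b e _ b)
    (markov_auxVar hp J a b e _ e), H_blk_coord hp _ fun s => (a s, b s),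
    H_blk_coord hp _ fun s => (a s, e s)]
  rw [Finset.sum_add_distrib, sum_H_auxVar_sub, Hc, Hc,
    H_blk_message hp J a b, H_blk_message hp J a e]
  simp
  ring

end Block

end SSW

namespace SSW

/-- The single-letter term of coordinate `i` is attained by an admissible joint pmf. -/
lemma cMI_auxVar_mem {𝒜 ℰ γ : Type} [Fintype 𝒜] [Fintype ℰ] [Fintype γ] {K : ℕ}
    (ℬ : Fin K → Type) [∀ k, Fintype (ℬ k)]
    (p : 𝒜 × (∀ k, ℬ k) × ℰ → ℝ) (hp : IsPMF p) (k : Fin K) {N : ℕ}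
    (J : (Fin N → 𝒜) → γ) (i : Fin N) :
    cMI (blk N p) (fun ω => (ω i).1) (fun ω => (ω i).2.1 k)
        (auxVar J (fun s => s.1) (fun s => s.2.1 k) (fun s => s.2.2) i) -
      cMI (blk N p) (fun ω => (ω i).1) (fun ω => (ω i).2.2)
        (auxVar J (fun s => s.1) (fun s => s.2.1 k) (fun s => s.2.2) i) ∈
    { d : ℝ | ∃ (n : ℕ) (q : 𝒜 × (∀ k', ℬ k') × ℰ × Fin n → ℝ),
        IsPMF q ∧
        (∀ a b e, (∑ u, q (a, b, e, u)) = p (a, b, e)) ∧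
        Markov q (fun x => x.2.2.2) (fun x => x.1) (fun x => (x.2.1 k, x.2.2.1)) ∧
        d = cMI q (fun x => x.1) (fun x => x.2.1 k) (fun x => x.2.2.2) -
            cMI q (fun x => x.1) (fun x => x.2.2.1) (fun x => x.2.2.2) } := by
  classical
  set U := auxVar J (fun s : 𝒜 × (∀ k, ℬ k) × ℰ => s.1) (fun s => s.2.1 k) (fun s => s.2.2) i
  let enc := Fintype.equivFin (γ × (Fin N → Option (ℬ k ⊕ ℰ)))
  let T : (Fin N → 𝒜 × (∀ k, ℬ k) × ℰ) → 𝒜 × (∀ k', ℬ k') × ℰ × Fin _ :=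
    fun ω => ((ω i).1, (ω i).2.1, (ω i).2.2, enc (U ω))
  refine ⟨_, pr (blk N p) T, isPMF_pr (isPMF_blk hp N) T, fun a b e => ?_, ?_, ?_⟩
  · have h := pr_blk_coord hp i (fun s => s) (a, b, e)
    have hid : pr p (fun s => s) (a, b, e) = p (a, b, e) := by
      rw [pr, Finset.sum_eq_single (a, b, e)] <;> simp +contextual
    rw [hid] at h
    rw [← h]
    simp only [pr]
    rw [Finset.sum_comm]
    refine Finset.sum_congr rfl fun ω _ => ?_
    rw [Finset.sum_eq_single (enc (U ω))]
    · simp [T, Prod.ext_iff]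
    · intro u _ hu
      simp [T, hu.symm]
    · simp
  · have hM : Markov (blk N p) U (fun ω => (ω i).1) (fun ω => ((ω i).2.1 k, (ω i).2.2)) :=
      markov_auxVar hp J _ _ _ i fun s => (s.2.1 k, s.2.2)
    intro u a z
    have h := hM (enc.symm u) a z
    simp only [pr_pr]
    have e1 : pr (blk N p) (fun ω => (enc (U ω), (ω i).1, (ω i).2.1 k, (ω i).2.2)) (u, a, z) =
        pr (blk N p) (fun ω => (U ω, (ω i).1, (ω i).2.1 k, (ω i).2.2)) (enc.symm u, a, z) :=
      pr_congr fun ω => by simp [Prod.ext_iff, Equiv.eq_symm_apply]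
    have e2 : pr (blk N p) (fun ω => (enc (U ω), (ω i).1)) (u, a) =
        pr (blk N p) (fun ω => (U ω, (ω i).1)) (enc.symm u, a) :=
      pr_congr fun ω => by simp [Prod.ext_iff, Equiv.eq_symm_apply]
    rw [← e1, ← e2] at h
    exact h
  · have hH : ∀ {κ : Type} [Fintype κ] (X : (Fin N → 𝒜 × (∀ k, ℬ k) × ℰ) → κ),
        H (blk N p) (fun ω => (X ω, enc (U ω))) = H (blk N p) (fun ω => (X ω, U ω)) :=
      fun X => H_congr fun ω ω' => by simp
    have hH0 : H (blk N p) (fun ω => enc (U ω)) = H (blk N p) U :=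
      H_congr fun ω ω' => by simp
    have hH2 : ∀ {κ δ : Type} [Fintype κ] [Fintype δ]
        (X : (Fin N → 𝒜 × (∀ k, ℬ k) × ℰ) → κ) (Y : (Fin N → 𝒜 × (∀ k, ℬ k) × ℰ) → δ),
        H (blk N p) (fun ω => (X ω, Y ω, enc (U ω))) = H (blk N p) (fun ω => (X ω, Y ω, U ω)) :=
      fun X Y => H_congr fun ω ω' => by simp
    simp only [cMI, Hc, H_pr, T, hH, hH0, hH2]

end SSW

/-- Multi-receiver equivocation upper bound: if `(R_A, Δ)` is achievable with `K` legitimate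
receivers and one eavesdropper, then for every `k`,
`Δ ≤ sup_{U_k} [ I(A;B_k|U_k) − I(A;E|U_k) ]`, the supremum being over finite-valued auxiliary
random variables `U_k` satisfying the Markov chain `U_k − A − (B_k, E)` (hence
`Δ ≤ min_k sup_{U_k} [⋯]`). -/
theorem multi_rx_equivocation_upper_bound {𝒜 ℰ : Type} [Fintype 𝒜] [Fintype ℰ] {K : ℕ}
    (ℬ : Fin K → Type) [∀ k, Fintype (ℬ k)]
    (p : 𝒜 × (∀ k, ℬ k) × ℰ → ℝ) (hp : IsPMF p)
    (RA Δ : ℝ) (hach : AchievableMultiRx ℬ p RA Δ) :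
    ∀ k : Fin K,
      Δ ≤ sSup { d : ℝ | ∃ (n : ℕ) (q : 𝒜 × (∀ k', ℬ k') × ℰ × Fin n → ℝ),
        IsPMF q ∧
        (∀ a b e, (∑ u, q (a, b, e, u)) = p (a, b, e)) ∧
        Markov q (fun x => x.2.2.2) (fun x => x.1) (fun x => (x.2.1 k, x.2.2.1)) ∧
        d = cMI q (fun x => x.1) (fun x => x.2.1 k) (fun x => x.2.2.2) -
            cMI q (fun x => x.1) (fun x => x.2.2.1) (fun x => x.2.2.2) } := by
  intro k
  classical
  set D : Set ℝ := { d : ℝ | ∃ (n : ℕ) (q : 𝒜 × (∀ k', ℬ k') × ℰ × Fin n → ℝ),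
    IsPMF q ∧
    (∀ a b e, (∑ u, q (a, b, e, u)) = p (a, b, e)) ∧
    Markov q (fun x => x.2.2.2) (fun x => x.1) (fun x => (x.2.1 k, x.2.2.1)) ∧
    d = cMI q (fun x => x.1) (fun x => x.2.1 k) (fun x => x.2.2.2) -
        cMI q (fun x => x.1) (fun x => x.2.2.1) (fun x => x.2.2.2) }
  have hbdd : BddAbove D := by
    refine ⟨Real.logb 2 (Fintype.card 𝒜), ?_⟩
    rintro d ⟨n, q, hq, -, -, rfl⟩
    exact cMI_sub_cMI_le hq _ _ _ _
  set L := Real.logb 2 (Fintype.card 𝒜)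
  have hbound : ∀ ε : ℝ, 0 < ε → ε < 1 →
      Δ ≤ sSup D + ε + (-Real.logb 2 (1 - ε) + (-(ε * Real.log ε) / Real.log 2 + ε * L)) := by
    intro ε hε hε1
    obtain ⟨N, M, hN, -, f, g, -, herr, heq⟩ := hach ε hε
    have hfano := Hc_le_of_decoder (isPMF_blk hp N) (fun ω i => (ω i).1)
      (fun ω => (f fun i => (ω i).1, fun i => (ω i).2.1 k)) (fun y => g k y.1 y.2) hε hε1 (herr k)
    have hsum := Hc_sub_Hc_eq_sum hp f (fun s => s.1) (fun s => s.2.1 k) (fun s => s.2.2)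
    have hterm := Finset.sum_le_card_nsmul Finset.univ _ (sSup D) fun i _ =>
      le_csSup hbdd (cMI_auxVar_mem ℬ p hp k f i)
    rw [← hsum, Finset.card_univ, Fintype.card_fin, nsmul_eq_mul] at hterm
    rw [Fintype.card_fun, Fintype.card_fin, Nat.cast_pow, Real.logb_pow] at hfano
    have hN1 : (1 : ℝ) ≤ N := by exact_mod_cast hN
    have hl : 0 ≤ -Real.logb 2 (1 - ε) + -(ε * Real.log ε) / Real.log 2 := by
      have h1 := Real.logb_nonpos one_lt_two (x := 1 - ε) (by linarith) (by linarith)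
      have h2 : 0 ≤ -(ε * Real.log ε) / Real.log 2 :=
        div_nonneg (neg_nonneg.2 (mul_nonpos_of_nonneg_of_nonpos hε.le
          (Real.log_nonpos hε.le hε1.le))) (Real.log_pos one_lt_two).le
      linarith
    have hle := le_mul_of_one_le_left hl hN1
    have he : ε * (-Real.logb 2 ε + N * L) =
        -(ε * Real.log ε) / Real.log 2 + N * (ε * L) := by
      rw [Real.logb]; ring
    rw [he] at hfano
    refine le_of_mul_le_mul_left ?_ (lt_of_lt_of_le one_pos hN1)
    linarith
  have hlim : Filter.Tendsto
      (fun ε : ℝ => sSup D + ε +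
        (-Real.logb 2 (1 - ε) + (-(ε * Real.log ε) / Real.log 2 + ε * L)))
      (nhdsWithin 0 (Set.Ioi 0)) (nhds (sSup D)) := by
    have hc : ContinuousAt (fun ε : ℝ => sSup D + ε +
        (-Real.logb 2 (1 - ε) + (-(ε * Real.log ε) / Real.log 2 + ε * L))) 0 := by
      have h1 := Real.continuous_mul_log.continuousAt (x := 0)
      have h2 : ContinuousAt (fun ε : ℝ => Real.log (1 - ε)) 0 :=
        ContinuousAt.log (by fun_prop) (by norm_num)
      simp only [Real.logb]
      fun_prop
    simpa using hc.tendsto.mono_left nhdsWithin_le_nhds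
  refine ge_of_tendsto hlim ?_
  filter_upwards [Ioo_mem_nhdsGT (zero_lt_one' ℝ)] with ε hε
  exact hbound ε hε.1 hε.2
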